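/- arXiv:2405.18081 — 7 statements merged into one kernel-verified Lean document; each statement's English description precedes it below -/
import Mathlib

section
/- Let μ be a Borel probability measure on ℝ, let φ : ℝ → [0,∞) be Borel measurable with φ > 0 μ-almost everywhere, let ν⊥ be a finite Borel measure concentrated on the set {λ : φ(λ) = 0} (i.e. ν⊥({λ : φ(λ) ≠ 0}) = 0), and suppose that ν := ν⊥ + μ.withDensity(1/φ) is a probability measure. Then for every ρ > 0: ∫ (ρ + φ(λ))⁻¹ dν(λ) = ρ⁻¹ · (1 − ∫ (ρ + φ(λ))⁻¹ dμ(λ)). -/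
open MeasureTheory

/-- Resolvent identity for the spectral measure `ν = ν⊥ + μ.withDensity (1/φ)` of the observed
matrix in the signal direction: `∫ (ρ+φ)⁻¹ dν = ρ⁻¹ (1 - ∫ (ρ+φ)⁻¹ dμ)`. -/
theorem stmt_8 (μ : Measure ℝ) [IsProbabilityMeasure μ]
    (φ : ℝ → ℝ) (hφm : Measurable φ) (hφnn : ∀ x, 0 ≤ φ x)
    (hφpos : ∀ᵐ x ∂μ, 0 < φ x)
    (νperp : Measure ℝ) [IsFiniteMeasure νperp]
    (hperp : νperp {x | φ x ≠ 0} = 0)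
    (hprob : IsProbabilityMeasure
      (νperp + μ.withDensity (fun x => ENNReal.ofReal (φ x)⁻¹)))
    (ρ : ℝ) (hρ : 0 < ρ) :
    ∫ x, (ρ + φ x)⁻¹ ∂(νperp + μ.withDensity (fun x => ENNReal.ofReal (φ x)⁻¹))
      = ρ⁻¹ * (1 - ∫ x, (ρ + φ x)⁻¹ ∂μ) := by
  have hsum : ∀ x, 0 < ρ + φ x := fun x => add_pos_of_pos_of_nonneg hρ (hφnn x)
  have hint : Integrable (fun x => φ x * (ρ + φ x)⁻¹)
      (νperp + μ.withDensity (fun x => ENNReal.ofReal (φ x)⁻¹)) := by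
    refine .of_bound (C := 1) (by fun_prop) (.of_forall fun x => ?_)
    rw [Real.norm_of_nonneg (mul_nonneg (hφnn x) (inv_nonneg.2 (hsum x).le)),
      ← div_eq_mul_inv, div_le_one (hsum x)]
    linarith
  have hφν : ∫ x, φ x * (ρ + φ x)⁻¹
      ∂(νperp + μ.withDensity (fun x => ENNReal.ofReal (φ x)⁻¹)) = ∫ x, (ρ + φ x)⁻¹ ∂μ := by
    have hparts := integrable_add_measure.1 hint
    have hzero : ∫ x, φ x * (ρ + φ x)⁻¹ ∂νperp = 0 := by
      refine integral_eq_zero_of_ae ?_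
      have hae : ∀ᵐ x ∂νperp, φ x = 0 := hperp
      filter_upwards [hae] with x hx
      simp [hx]
    rw [integral_add_measure hparts.1 hparts.2, hzero, zero_add,
      integral_withDensity_eq_integral_toReal_smul (by fun_prop) (by simp)]
    refine integral_congr_ae ?_
    filter_upwards [hφpos] with x hx
    rw [ENNReal.toReal_ofReal (inv_nonneg.2 hx.le), smul_eq_mul, inv_mul_cancel_left₀ hx.ne']
  generalize νperp + μ.withDensity (fun x => ENNReal.ofReal (φ x)⁻¹) = ν at *
  calc ∫ x, (ρ + φ x)⁻¹ ∂ν = ∫ x, ρ⁻¹ * (1 - φ x * (ρ + φ x)⁻¹) ∂ν := by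
        congr 1 with x
        have := (hsum x).ne'
        field_simp
        ring
    _ = ρ⁻¹ * (1 - ∫ x, (ρ + φ x)⁻¹ ∂μ) := by
        rw [integral_const_mul, integral_sub (integrable_const 1) hint, hφν]
        simp
end

section
/- Let μ be a Borel probability measure on ℝ, let φ : ℝ → [0,∞) be Borel measurable with φ > 0 μ-almost everywhere, let ν⊥ be a finite Borel measure concentrated on {λ : φ(λ) = 0}, and suppose ν := ν⊥ + μ.withDensity(1/φ) is a probability measure. Fix ρ > 0, set c := ∫ φ(λ)/(φ(λ)+ρ) dμ(λ) (which is positive), and define the matrix denoiser Ψ⋆(λ) := 1 − c⁻¹ · φ(λ)/(φ(λ)+ρ). Then Ψ⋆ is trace-free, i.e. ∫ Ψ⋆ dμ = 0, and Ψ⋆ minimizes the variational problem: for every Borel Ψ : ℝ → ℝ with ∫ Ψ² d(μ+ν) < ∞ and ∫ Ψ dμ = 0, one has ∫ (Ψ⋆ − 1)² dν + ρ⁻¹ ∫ Ψ⋆² dμ ≤ ∫ (Ψ − 1)² dν + ρ⁻¹ ∫ Ψ² dμ. -/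
open MeasureTheory

/-- Integrals against `μ.withDensity (1/φ)` are integrals of `φ⁻¹ • f` against `μ`. -/
theorem integral_withDensity_ofReal_inv {α : Type*} [MeasurableSpace α] (μ : Measure α)
    {φ : α → ℝ} (hφm : Measurable φ) (hφnn : ∀ x, 0 ≤ φ x) (f : α → ℝ) :
    ∫ x, f x ∂μ.withDensity (fun x => ENNReal.ofReal (φ x)⁻¹) = ∫ x, (φ x)⁻¹ * f x ∂μ := by
  rw [integral_withDensity_eq_integral_toReal_smul (by fun_prop)
    (.of_forall fun _ => ENNReal.ofReal_lt_top)]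
  simp [ENNReal.toReal_ofReal, hφnn]

/-- Integrability against `μ.withDensity (1/φ)` gives integrability of `φ⁻¹ * f` against `μ`. -/
theorem integrable_inv_mul_of_withDensity_ofReal_inv {α : Type*} [MeasurableSpace α]
    (μ : Measure α) {φ : α → ℝ} (hφm : Measurable φ) (hφnn : ∀ x, 0 ≤ φ x) {f : α → ℝ}
    (hf : Integrable f (μ.withDensity (fun x => ENNReal.ofReal (φ x)⁻¹))) :
    Integrable (fun x => (φ x)⁻¹ * f x) μ := by
  rw [integrable_withDensity_iff_integrable_smul' (by fun_prop)
    (.of_forall fun _ => ENNReal.ofReal_lt_top)] at hf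
  simpa [ENNReal.toReal_ofReal, hφnn] using hf

/-- The objective splits into a singular part against `νperp` and a part against `μ`. -/
theorem objective_eq_integral_perp_add {α : Type*} [MeasurableSpace α] (μ νperp : Measure α)
    {φ : α → ℝ} (hφm : Measurable φ) (hφnn : ∀ x, 0 ≤ φ x) (ρ : ℝ) {f : α → ℝ}
    (hν : Integrable (fun x => (f x - 1) ^ 2)
      (νperp + μ.withDensity (fun x => ENNReal.ofReal (φ x)⁻¹)))
    (hμ : Integrable (fun x => f x ^ 2) μ) :
    Integrable (fun x => (φ x)⁻¹ * (f x - 1) ^ 2 + ρ⁻¹ * f x ^ 2) μ ∧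
    (∫ x, (f x - 1) ^ 2 ∂(νperp + μ.withDensity (fun x => ENNReal.ofReal (φ x)⁻¹)))
        + ρ⁻¹ * ∫ x, f x ^ 2 ∂μ =
      (∫ x, (f x - 1) ^ 2 ∂νperp) +
        ∫ x, ((φ x)⁻¹ * (f x - 1) ^ 2 + ρ⁻¹ * f x ^ 2) ∂μ := by
  have h := integrable_inv_mul_of_withDensity_ofReal_inv μ hφm hφnn hν.right_of_add_measure
  refine ⟨h.add (hμ.const_mul _), ?_⟩
  rw [integral_add_measure hν.left_of_add_measure hν.right_of_add_measure,
    integral_withDensity_ofReal_inv μ hφm hφnn, integral_add h (hμ.const_mul _),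
    integral_const_mul, add_assoc]

/-- Tangent-line bound for the pointwise objective at the optimal denoiser. -/
theorem pointwise_objective_tangent_bound {p ρ c : ℝ} (hp : 0 < p) (hρ : 0 < ρ) (t : ℝ) :
    (p⁻¹ * ((1 - c⁻¹ * (p / (p + ρ))) - 1) ^ 2 + ρ⁻¹ * (1 - c⁻¹ * (p / (p + ρ))) ^ 2)
        + 2 * ρ⁻¹ * (1 - c⁻¹) * (t - (1 - c⁻¹ * (p / (p + ρ)))) ≤
      p⁻¹ * (t - 1) ^ 2 + ρ⁻¹ * t ^ 2 := by
  have key : p⁻¹ * (t - 1) ^ 2 + ρ⁻¹ * t ^ 2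
      - ((p⁻¹ * ((1 - c⁻¹ * (p / (p + ρ))) - 1) ^ 2 + ρ⁻¹ * (1 - c⁻¹ * (p / (p + ρ))) ^ 2)
        + 2 * ρ⁻¹ * (1 - c⁻¹) * (t - (1 - c⁻¹ * (p / (p + ρ)))))
      = (p⁻¹ + ρ⁻¹) * (t - (1 - c⁻¹ * (p / (p + ρ)))) ^ 2 := by
    generalize c⁻¹ = d
    have : p + ρ ≠ 0 := by positivity
    field_simp
    ring
  have : 0 ≤ (p⁻¹ + ρ⁻¹) * (t - (1 - c⁻¹ * (p / (p + ρ)))) ^ 2 := by positivity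
  linarith

/-- The optimal matrix denoiser `Ψ⋆(λ) = 1 - c⁻¹ φ(λ)/(φ(λ)+ρ)` is trace free and minimizes
the variational problem `∫ (Ψ-1)² dν + ρ⁻¹ ∫ Ψ² dμ` over trace-free square-integrable `Ψ`. -/
theorem stmt_9 (μ : Measure ℝ) [IsProbabilityMeasure μ]
    (φ : ℝ → ℝ) (hφm : Measurable φ) (hφnn : ∀ x, 0 ≤ φ x)
    (hφpos : ∀ᵐ x ∂μ, 0 < φ x)
    (νperp : Measure ℝ) [IsFiniteMeasure νperp]
    (hperp : νperp {x | φ x ≠ 0} = 0)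
    (hprob : IsProbabilityMeasure
      (νperp + μ.withDensity (fun x => ENNReal.ofReal (φ x)⁻¹)))
    (ρ : ℝ) (hρ : 0 < ρ) :
    let ν : Measure ℝ := νperp + μ.withDensity (fun x => ENNReal.ofReal (φ x)⁻¹)
    let c : ℝ := ∫ x, φ x / (φ x + ρ) ∂μ
    let Ψs : ℝ → ℝ := fun x => 1 - c⁻¹ * (φ x / (φ x + ρ))
    0 < c ∧ (∫ x, Ψs x ∂μ) = 0 ∧
      ∀ Ψ : ℝ → ℝ, Measurable Ψ → Integrable (fun x => Ψ x ^ 2) (μ + ν) →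
        (∫ x, Ψ x ∂μ) = 0 →
        (∫ x, (Ψs x - 1) ^ 2 ∂ν) + ρ⁻¹ * ∫ x, Ψs x ^ 2 ∂μ ≤
          (∫ x, (Ψ x - 1) ^ 2 ∂ν) + ρ⁻¹ * ∫ x, Ψ x ^ 2 ∂μ := by
  intro ν c Ψs
  have : IsProbabilityMeasure ν := hprob
  have hr0 : ∀ x, 0 ≤ φ x / (φ x + ρ) := fun x => by have := hφnn x; positivity
  have hr1 : ∀ x, φ x / (φ x + ρ) ≤ 1 := fun x => by
    have := hφnn x
    rw [div_le_one (by positivity)]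
    linarith
  have hrm : Measurable fun x => φ x / (φ x + ρ) := by fun_prop
  have hrL (m : Measure ℝ) [IsFiniteMeasure m] (q : ENNReal) :
      MemLp (fun x => φ x / (φ x + ρ)) q m :=
    MemLp.of_bound hrm.aestronglyMeasurable 1 (.of_forall fun x => by
      rw [Real.norm_of_nonneg (hr0 x)]
      exact hr1 x)
  have hri : Integrable (fun x => φ x / (φ x + ρ)) μ := memLp_one_iff_integrable.1 (hrL μ 1)
  have hc : 0 < c := by
    refine (integral_nonneg hr0).lt_of_ne' fun h => ?_
    have h0 := (integral_eq_zero_iff_of_nonneg hr0 hri).1 h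
    have hfalse : ∀ᵐ x ∂μ, False := by
      filter_upwards [h0, hφpos] with x hx hpos
      have : 0 < φ x / (φ x + ρ) := by positivity
      exact this.ne' hx
    simp at hfalse
    exact IsProbabilityMeasure.ne_zero μ hfalse
  have hΨsL (m : Measure ℝ) [IsFiniteMeasure m] (q : ENNReal) : MemLp Ψs q m :=
    (memLp_const 1).sub ((hrL m q).const_mul _)
  have hΨs0 : ∫ x, Ψs x ∂μ = 0 := by
    simp only [Ψs]
    rw [integral_sub (integrable_const _) (hri.const_mul _), integral_const_mul]
    change _ - c⁻¹ * c = 0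
    simp [hc.ne']
  refine ⟨hc, hΨs0, fun Ψ hΨm hΨ2 hΨ0 => ?_⟩
  have hΨLμ : MemLp Ψ 2 μ :=
    (memLp_two_iff_integrable_sq hΨm.aestronglyMeasurable).2 hΨ2.left_of_add_measure
  have hΨLν : MemLp Ψ 2 ν :=
    (memLp_two_iff_integrable_sq hΨm.aestronglyMeasurable).2 hΨ2.right_of_add_measure
  obtain ⟨hI, hE⟩ := objective_eq_integral_perp_add μ νperp hφm hφnn ρ
    (hΨLν.sub (memLp_const 1)).integrable_sq hΨLμ.integrable_sq
  obtain ⟨hIs, hEs⟩ := objective_eq_integral_perp_add μ νperp hφm hφnn ρ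
    ((hΨsL ν 2).sub (memLp_const 1)).integrable_sq (hΨsL μ 2).integrable_sq
  rw [hE, hEs]
  have hperp0 : ∫ x, (Ψs x - 1) ^ 2 ∂νperp = 0 := by
    refine integral_eq_zero_of_ae ?_
    have h : ∀ᵐ x ∂νperp, φ x = 0 := hperp
    filter_upwards [h] with x hx
    simp [Ψs, hx]
  have hΨi : Integrable Ψ μ := hΨLμ.integrable one_le_two
  have hΨsi : Integrable Ψs μ := (hΨsL μ 2).integrable one_le_two
  have hlin : Integrable (fun x => 2 * ρ⁻¹ * (1 - c⁻¹) * (Ψ x - Ψs x)) μ :=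
    (hΨi.sub hΨsi).const_mul _
  have hle := integral_mono_ae (hIs.add hlin) hI (by
    filter_upwards [hφpos] with x hx
    exact pointwise_objective_tangent_bound hx hρ (Ψ x))
  simp only [Pi.add_apply] at hle
  rw [integral_add hIs hlin, integral_const_mul, integral_sub hΨi hΨsi, hΨ0, hΨs0] at hle
  have hnn : 0 ≤ ∫ x, (Ψ x - 1) ^ 2 ∂νperp := integral_nonneg fun x => sq_nonneg _
  linarith
end

section
/- Let μ be a Borel probability measure on ℝ, let φ : ℝ → [0,∞) be Borel measurable with φ > 0 μ-almost everywhere, let ν⊥ be a finite Borel measure concentrated on {λ : φ(λ) = 0}, and suppose ν := ν⊥ + μ.withDensity(1/φ) is a probability measure. Fix ρ > 0, set c := ∫ φ/(φ+ρ) dμ and Ψ⋆(λ) := 1 − c⁻¹ · φ(λ)/(φ(λ)+ρ). Then the effective SNR ω := ∫ Ψ⋆ dν satisfies both ω = 1 − c⁻¹ · ∫ (φ(λ)+ρ)⁻¹ dμ(λ) and the second-moment identity ∫ Ψ⋆² dν + ρ⁻¹ ∫ Ψ⋆² dμ = ω. -/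
open MeasureTheory

/-- Functions vanishing where `φ` does integrate against `νperp + (1/φ) μ` as `φ⁻¹ * F` against
`μ`. -/
theorem integral_add_withDensity_inv {α : Type*} [MeasurableSpace α] {μ νperp : Measure α}
    {φ F : α → ℝ} (hφm : Measurable φ) (hφnn : ∀ x, 0 ≤ φ x)
    (hperp : νperp {x | φ x ≠ 0} = 0) (hF0 : ∀ x, φ x = 0 → F x = 0)
    (hF : Integrable F (νperp + μ.withDensity (fun x => ENNReal.ofReal (φ x)⁻¹))) :
    ∫ x, F x ∂(νperp + μ.withDensity (fun x => ENNReal.ofReal (φ x)⁻¹))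
      = ∫ x, (φ x)⁻¹ * F x ∂μ := by
  have hF_perp : F =ᵐ[νperp] 0 := by
    have h : ∀ᵐ x ∂νperp, φ x = 0 := hperp
    filter_upwards [h] with x hx using hF0 x hx
  rw [integral_add_measure hF.left_of_add_measure hF.right_of_add_measure,
    integral_congr_ae hF_perp,
    integral_withDensity_eq_integral_toReal_smul
      (f := fun x => ENNReal.ofReal (φ x)⁻¹) hφm.inv.ennreal_ofReal (by simp)]
  simp [hφnn]

/-- Expansion of the second moment of an affine function under a probability measure. -/
theorem integral_one_sub_const_mul_sq {α : Type*} [MeasurableSpace α] {m : Measure α}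
    [IsProbabilityMeasure m] {g : α → ℝ} (hg : Integrable g m)
    (hg2 : Integrable (fun x => g x ^ 2) m) (a : ℝ) :
    ∫ x, (1 - a * g x) ^ 2 ∂m = 1 - 2 * a * ∫ x, g x ∂m + a ^ 2 * ∫ x, g x ^ 2 ∂m := by
  have h : (fun x => (1 - a * g x) ^ 2) = fun x => (1 - 2 * a * g x) + a ^ 2 * g x ^ 2 := by
    funext x
    ring
  have h1 : Integrable (fun x => 1 - 2 * a * g x) m := (integrable_const _).sub (hg.const_mul _)
  rw [h, integral_add h1 (hg2.const_mul _),
    integral_sub (integrable_const _) (hg.const_mul _), integral_const_mul, integral_const_mul]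
  simp

/-- The effective SNR `ω = ∫ Ψ⋆ dν` of the optimal matrix denoiser satisfies
`ω = 1 - c⁻¹ ∫ (φ+ρ)⁻¹ dμ` and the second-moment identity
`∫ Ψ⋆² dν + ρ⁻¹ ∫ Ψ⋆² dμ = ω`. -/
theorem stmt_10 (μ : Measure ℝ) [IsProbabilityMeasure μ]
    (φ : ℝ → ℝ) (hφm : Measurable φ) (hφnn : ∀ x, 0 ≤ φ x)
    (hφpos : ∀ᵐ x ∂μ, 0 < φ x)
    (νperp : Measure ℝ) [IsFiniteMeasure νperp]
    (hperp : νperp {x | φ x ≠ 0} = 0)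
    (hprob : IsProbabilityMeasure
      (νperp + μ.withDensity (fun x => ENNReal.ofReal (φ x)⁻¹)))
    (ρ : ℝ) (hρ : 0 < ρ) :
    let ν : Measure ℝ := νperp + μ.withDensity (fun x => ENNReal.ofReal (φ x)⁻¹)
    let c : ℝ := ∫ x, φ x / (φ x + ρ) ∂μ
    let Ψs : ℝ → ℝ := fun x => 1 - c⁻¹ * (φ x / (φ x + ρ))
    let ω : ℝ := ∫ x, Ψs x ∂ν
    ω = 1 - c⁻¹ * ∫ x, (φ x + ρ)⁻¹ ∂μ ∧
      (∫ x, Ψs x ^ 2 ∂ν) + ρ⁻¹ * ∫ x, Ψs x ^ 2 ∂μ = ω := by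
  intro ν c Ψs ω
  have : IsProbabilityMeasure ν := hprob
  set g : ℝ → ℝ := fun x => φ x / (φ x + ρ) with hg_def
  have hden : ∀ x, 0 < φ x + ρ := fun x => add_pos_of_nonneg_of_pos (hφnn x) hρ
  have hg_nonneg : ∀ x, 0 ≤ g x := fun x => div_nonneg (hφnn x) (hden x).le
  have hg_le : ∀ x, g x ≤ 1 := fun x => (div_le_one (hden x)).2 (by linarith)
  have hg_meas : Measurable g := hφm.div (hφm.add_const ρ)
  have hg_int (m : Measure ℝ) [IsFiniteMeasure m] : Integrable g m :=
    .of_bound hg_meas.aestronglyMeasurable 1 <| .of_forall fun x => by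
      rw [Real.norm_of_nonneg (hg_nonneg x)]
      exact hg_le x
  have hg2_int (m : Measure ℝ) [IsFiniteMeasure m] : Integrable (fun x => g x ^ 2) m :=
    .of_bound (hg_meas.pow_const 2).aestronglyMeasurable 1 <| .of_forall fun x => by
      rw [Real.norm_of_nonneg (sq_nonneg _)]
      exact pow_le_one₀ (hg_nonneg x) (hg_le x)
  have hinv_int : Integrable (fun x => (φ x + ρ)⁻¹) μ :=
    .of_bound (hφm.add_const ρ).inv.aestronglyMeasurable ρ⁻¹ <| .of_forall fun x => by
      rw [Real.norm_of_nonneg (inv_nonneg.2 (hden x).le)]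
      exact inv_anti₀ hρ (by linarith [hφnn x])
  have hc : 0 < c := by
    refine (integral_pos_iff_support_of_nonneg hg_nonneg (hg_int μ)).2 ?_
    have h : Function.support g =ᵐ[μ] Set.univ := by
      rw [ae_eq_univ, ← mem_ae_iff]
      filter_upwards [hφpos] with x hx using (div_pos hx (hden x)).ne'
    rw [measure_congr h]
    simp
  have hgν : ∫ x, g x ∂ν = ∫ x, (φ x + ρ)⁻¹ ∂μ := by
    rw [integral_add_withDensity_inv hφm hφnn hperp (fun x hx => by simp [hg_def, hx]) (hg_int ν)]
    refine integral_congr_ae ?_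
    filter_upwards [hφpos] with x hx
    have := (hden x).ne'
    simp only [hg_def]
    field_simp
  have hg2 : ∫ x, g x ^ 2 ∂ν + ρ⁻¹ * ∫ x, g x ^ 2 ∂μ = ρ⁻¹ * c := by
    have hint : Integrable (fun x => (φ x)⁻¹ * g x ^ 2) μ := by
      refine ((hg_int μ).sub (hg2_int μ)).const_mul ρ⁻¹ |>.congr ?_
      filter_upwards [hφpos] with x hx
      have := (hden x).ne'
      simp only [hg_def, Pi.sub_apply]
      field_simp
      ring
    rw [integral_add_withDensity_inv hφm hφnn hperp (fun x hx => by simp [hg_def, hx])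
      (hg2_int ν), ← integral_const_mul, ← integral_add hint ((hg2_int μ).const_mul _),
      ← integral_const_mul]
    refine integral_congr_ae ?_
    filter_upwards [hφpos] with x hx
    have := (hden x).ne'
    simp only [hg_def]
    field_simp
    ring
  have hcd : c + ρ * ∫ x, (φ x + ρ)⁻¹ ∂μ = 1 := by
    rw [← integral_const_mul, ← integral_add (hg_int μ) (hinv_int.const_mul _)]
    have h : ∀ x, g x + ρ * (φ x + ρ)⁻¹ = 1 := fun x => by
      have := (hden x).ne'
      simp only [hg_def]
      field_simp
    simp [h]
  have hω : ω = 1 - c⁻¹ * ∫ x, (φ x + ρ)⁻¹ ∂μ := by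
    rw [← hgν, ← integral_const_mul]
    change ∫ x, (1 - c⁻¹ * g x) ∂ν = _
    rw [integral_sub (integrable_const _) ((hg_int ν).const_mul _)]
    simp
  refine ⟨hω, ?_⟩
  rw [hω]
  change ∫ x, (1 - c⁻¹ * g x) ^ 2 ∂ν + ρ⁻¹ * ∫ x, (1 - c⁻¹ * g x) ^ 2 ∂μ = _
  rw [integral_one_sub_const_mul_sq (hg_int ν) (hg2_int ν),
    integral_one_sub_const_mul_sq (hg_int μ) (hg2_int μ), hgν]
  change _ + ρ⁻¹ * (1 - 2 * c⁻¹ * c + _) = _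
  have hc' := hc.ne'
  generalize ∫ x, g x ^ 2 ∂ν = e at *
  generalize ∫ x, g x ^ 2 ∂μ = f at *
  generalize ∫ x, (φ x + ρ)⁻¹ ∂μ = d at *
  obtain rfl : e = ρ⁻¹ * c - ρ⁻¹ * f := by linarith
  field_simp
  linear_combination -c * hcd
end

section
/- Let μ and ν be finite Borel measures on ℝ that are not mutually singular, and let ρ > 0. Then the variational infimum is strictly positive: there exists ε > 0 such that for every Borel function Ψ : ℝ → ℝ, ∫ (Ψ − 1)² dν + ρ⁻¹ ∫ Ψ² dμ ≥ ε. -/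
open MeasureTheory

/-- Two measures that are not mutually singular dominate a common nonzero measure. -/
lemma exists_ne_zero_le_le_of_not_mutuallySingular {α : Type*} {_ : MeasurableSpace α}
    {μ ν : Measure α} (h : ¬ μ ⟂ₘ ν) : ∃ κ : Measure α, κ ≠ 0 ∧ κ ≤ μ ∧ κ ≤ ν := by
  by_contra! H
  refine h (Measure.mutuallySingular_of_disjoint fun κ hμ hν ↦ ?_)
  by_contra hκ
  exact H κ (fun h0 ↦ hκ h0.le) hμ hν

/-- If `μ` and `ν` are finite measures that are not mutually singular and `ρ > 0`, then the
variational objective `∫ (Ψ-1)² dν + ρ⁻¹ ∫ Ψ² dμ` is bounded below by a positive constant,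
uniformly over Borel functions `Ψ`. -/
theorem stmt_11 (μ ν : Measure ℝ) [IsFiniteMeasure μ] [IsFiniteMeasure ν]
    (h : ¬ μ ⟂ₘ ν) (ρ : ℝ) (hρ : 0 < ρ) :
    ∃ ε : ℝ, 0 < ε ∧ ∀ Ψ : ℝ → ℝ, Measurable Ψ →
      ENNReal.ofReal ε ≤
        (∫⁻ x, ENNReal.ofReal ((Ψ x - 1) ^ 2) ∂ν) +
          ENNReal.ofReal ρ⁻¹ * ∫⁻ x, ENNReal.ofReal (Ψ x ^ 2) ∂μ := by
  obtain ⟨κ, hκ, hμ, hν⟩ := exists_ne_zero_le_le_of_not_mutuallySingular h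
  have : IsFiniteMeasure κ := isFiniteMeasure_of_le μ hμ
  have : NeZero κ := ⟨hκ⟩
  have hc : 0 < min 1 ρ⁻¹ := lt_min one_pos (inv_pos.2 hρ)
  have hκ_pos : 0 < κ.real Set.univ := measureReal_univ_pos
  refine ⟨min 1 ρ⁻¹ / 2 * κ.real Set.univ, by positivity, fun Ψ hΨ ↦ ?_⟩
  calc ENNReal.ofReal (min 1 ρ⁻¹ / 2 * κ.real Set.univ)
      = ∫⁻ _, ENNReal.ofReal (min 1 ρ⁻¹ / 2) ∂κ := by
        rw [lintegral_const, ENNReal.ofReal_mul (by positivity), ofReal_measureReal]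
    _ ≤ ∫⁻ x, (ENNReal.ofReal ((Ψ x - 1) ^ 2)
          + ENNReal.ofReal ρ⁻¹ * ENNReal.ofReal (Ψ x ^ 2)) ∂κ := by
        refine lintegral_mono fun x ↦ ?_
        rw [← ENNReal.ofReal_mul (by positivity), ← ENNReal.ofReal_add (by positivity)
          (by positivity)]
        refine ENNReal.ofReal_le_ofReal ?_
        nlinarith [mul_le_mul_of_nonneg_right (min_le_left 1 ρ⁻¹) (sq_nonneg (Ψ x - 1)),
          mul_le_mul_of_nonneg_right (min_le_right 1 ρ⁻¹) (sq_nonneg (Ψ x)),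
          mul_nonneg hc.le (sq_nonneg (2 * Ψ x - 1))]
    _ = (∫⁻ x, ENNReal.ofReal ((Ψ x - 1) ^ 2) ∂κ)
          + ENNReal.ofReal ρ⁻¹ * ∫⁻ x, ENNReal.ofReal (Ψ x ^ 2) ∂κ := by
        rw [lintegral_add_left (by fun_prop), lintegral_const_mul _ (by fun_prop)]
    _ ≤ _ := by gcongr
end

section
/- Let μ be a finite Borel measure on ℝ, ν a Borel probability measure on ℝ, and ρ > 0. Then the maximal squared signal-to-noise ratio over trace-free matrix denoisers equals one minus the minimal quadratic objective: sup { (∫ Ψ dν)² / (∫ Ψ² dν + ρ⁻¹ ∫ Ψ² dμ) : Ψ Borel, ∫ Ψ² d(μ+ν) < ∞, ∫ Ψ dμ = 0 } = 1 − inf { ∫ (Ψ − 1)² dν + ρ⁻¹ ∫ Ψ² dμ : Ψ Borel, ∫ Ψ² d(μ+ν) < ∞, ∫ Ψ dμ = 0 }, where in the supremum the ratio is taken to be 0 whenever its denominator vanishes. -/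
open MeasureTheory

theorem integrable_of_integrable_sq {α : Type*} [MeasurableSpace α] {ν : Measure α}
    [IsFiniteMeasure ν] {f : α → ℝ} (hf : AEStronglyMeasurable f ν)
    (hf2 : Integrable (fun x => f x ^ 2) ν) : Integrable f ν :=
  ((memLp_two_iff_integrable_sq hf).2 hf2).integrable one_le_two

theorem integral_sub_const_sq {α : Type*} [MeasurableSpace α] {ν : Measure α}
    [IsProbabilityMeasure ν] {f : α → ℝ} (hf : AEStronglyMeasurable f ν)
    (hf2 : Integrable (fun x => f x ^ 2) ν) (c : ℝ) :
    ∫ x, (f x - c) ^ 2 ∂ν = (∫ x, f x ^ 2 ∂ν) - 2 * c * (∫ x, f x ∂ν) + c ^ 2 := by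
  have hf1 := integrable_of_integrable_sq hf hf2
  have hsub : Integrable (fun x => f x ^ 2 - 2 * c * f x) ν := hf2.sub (hf1.const_mul _)
  have h : ∀ x, (f x - c) ^ 2 = f x ^ 2 - 2 * c * f x + c ^ 2 := fun x => by ring
  simp_rw [h]
  rw [integral_add hsub (integrable_const _),
    integral_sub hf2 (hf1.const_mul _), integral_const_mul]
  simp

theorem sq_integral_le_integral_sq {α : Type*} [MeasurableSpace α] {ν : Measure α}
    [IsProbabilityMeasure ν] {f : α → ℝ} (hf : AEStronglyMeasurable f ν)
    (hf2 : Integrable (fun x => f x ^ 2) ν) :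
    (∫ x, f x ∂ν) ^ 2 ≤ ∫ x, f x ^ 2 ∂ν := by
  have h : 0 ≤ ∫ x, (f x - ∫ y, f y ∂ν) ^ 2 ∂ν := integral_nonneg fun x => sq_nonneg _
  rw [integral_sub_const_sq hf hf2] at h
  linarith

/-- The maximal squared SNR over trace-free matrix denoisers equals one minus the minimal
quadratic objective (with the convention that a ratio with vanishing denominator is `0`). -/
theorem stmt_12 (μ : Measure ℝ) [IsFiniteMeasure μ] (ν : Measure ℝ) [IsProbabilityMeasure ν]
    (ρ : ℝ) (hρ : 0 < ρ) :
    sSup {r : ℝ | ∃ Ψ : ℝ → ℝ, Measurable Ψ ∧ Integrable (fun x => Ψ x ^ 2) (μ + ν) ∧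
        (∫ x, Ψ x ∂μ) = 0 ∧
        r = (∫ x, Ψ x ∂ν) ^ 2 / ((∫ x, Ψ x ^ 2 ∂ν) + ρ⁻¹ * ∫ x, Ψ x ^ 2 ∂μ)} =
      1 - sInf {r : ℝ | ∃ Ψ : ℝ → ℝ, Measurable Ψ ∧ Integrable (fun x => Ψ x ^ 2) (μ + ν) ∧
        (∫ x, Ψ x ∂μ) = 0 ∧
        r = (∫ x, (Ψ x - 1) ^ 2 ∂ν) + ρ⁻¹ * ∫ x, Ψ x ^ 2 ∂μ} := by
  have hρ' : 0 < ρ⁻¹ := inv_pos.2 hρ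
  have sq_int_nonneg (m : Measure ℝ) (Ψ : ℝ → ℝ) : 0 ≤ ∫ x, Ψ x ^ 2 ∂m :=
    integral_nonneg fun x => sq_nonneg _
  have le_denom {Ψ : ℝ → ℝ} (hm : Measurable Ψ)
      (hi : Integrable (fun x => Ψ x ^ 2) (μ + ν)) :
      (∫ x, Ψ x ∂ν) ^ 2 ≤ (∫ x, Ψ x ^ 2 ∂ν) + ρ⁻¹ * ∫ x, Ψ x ^ 2 ∂μ := by
    have h := sq_integral_le_integral_sq hm.aestronglyMeasurable hi.right_of_add_measure
    have := mul_nonneg hρ'.le (sq_int_nonneg μ Ψ)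
    linarith
  set S := {r : ℝ | ∃ Ψ : ℝ → ℝ, Measurable Ψ ∧ Integrable (fun x => Ψ x ^ 2) (μ + ν) ∧
        (∫ x, Ψ x ∂μ) = 0 ∧
        r = (∫ x, Ψ x ∂ν) ^ 2 / ((∫ x, Ψ x ^ 2 ∂ν) + ρ⁻¹ * ∫ x, Ψ x ^ 2 ∂μ)}
  set T := {r : ℝ | ∃ Ψ : ℝ → ℝ, Measurable Ψ ∧ Integrable (fun x => Ψ x ^ 2) (μ + ν) ∧
        (∫ x, Ψ x ∂μ) = 0 ∧
        r = (∫ x, (Ψ x - 1) ^ 2 ∂ν) + ρ⁻¹ * ∫ x, Ψ x ^ 2 ∂μ}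
  have hS0 : (0 : ℝ) ∈ S := ⟨fun _ => 0, measurable_const, by simp, by simp, by simp⟩
  have hT1 : (1 : ℝ) ∈ T := ⟨fun _ => 0, measurable_const, by simp, by simp, by simp⟩
  have hTb : BddBelow T := by
    refine ⟨0, ?_⟩
    rintro r ⟨Ψ, -, -, -, rfl⟩
    exact add_nonneg (sq_int_nonneg ν fun x => Ψ x - 1) (mul_nonneg hρ'.le (sq_int_nonneg μ Ψ))
  have hSb : BddAbove S := by
    refine ⟨1, ?_⟩
    rintro r ⟨Ψ, hm, hi, -, rfl⟩
    have h := le_denom hm hi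
    exact div_le_one_of_le₀ h ((sq_nonneg _).trans h)
  apply le_antisymm
  · refine csSup_le ⟨0, hS0⟩ ?_
    rintro r ⟨Ψ, hm, hi, h0, rfl⟩
    have hD := (sq_nonneg _).trans (le_denom hm hi)
    set a := ∫ x, Ψ x ∂ν
    set D := (∫ x, Ψ x ^ 2 ∂ν) + ρ⁻¹ * ∫ x, Ψ x ^ 2 ∂μ with hDdef
    have hmem : 1 - a ^ 2 / D ∈ T := by
      have hsq : ∀ x, (a / D * Ψ x) ^ 2 = (a / D) ^ 2 * Ψ x ^ 2 := fun x => mul_pow _ _ _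
      have hi' : Integrable (fun x => (a / D * Ψ x) ^ 2) (μ + ν) := by
        simpa only [hsq] using hi.const_mul ((a / D) ^ 2)
      have hm' : Measurable fun x => a / D * Ψ x := hm.const_mul _
      refine ⟨fun x => a / D * Ψ x, hm', hi', by rw [integral_const_mul, h0, mul_zero], ?_⟩
      rw [integral_sub_const_sq hm'.aestronglyMeasurable hi'.right_of_add_measure]
      simp_rw [hsq, integral_const_mul]
      have key : 1 - a ^ 2 / D = (a / D) ^ 2 * D - 2 * (a / D * a) + 1 := by
        rcases hD.eq_or_lt with h | h
        · simp [← h]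
        · field_simp
          ring
      rw [key, hDdef]
      ring
    linarith [csInf_le hTb hmem]
  · rw [sub_le_comm]
    refine le_csInf ⟨1, hT1⟩ ?_
    rintro r ⟨Ψ, hm, hi, h0, rfl⟩
    have hle := le_csSup hSb ⟨Ψ, hm, hi, h0, rfl⟩
    rw [integral_sub_const_sq hm.aestronglyMeasurable hi.right_of_add_measure]
    have haD := le_denom hm hi
    set a := ∫ x, Ψ x ∂ν
    set D := (∫ x, Ψ x ^ 2 ∂ν) + ρ⁻¹ * ∫ x, Ψ x ^ 2 ∂μ with hDdef
    have key : 2 * a - D ≤ a ^ 2 / D := by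
      rcases ((sq_nonneg a).trans haD).eq_or_lt with h | h
      · have : a = 0 := by
          rw [← h] at haD
          exact pow_eq_zero_iff two_ne_zero |>.1 (le_antisymm haD (sq_nonneg a))
        simp [this, ← h]
      · rw [le_div_iff₀ h]
        nlinarith [sq_nonneg (a - D)]
    linarith
end

section
/- Let μ be a compactly supported Borel probability measure on ℝ, let ν be a compactly supported finite Borel measure on ℝ, and let ρ > 0. For D ∈ ℕ define L_D := inf { ∫ (p − 1)² dν + ρ⁻¹ ∫ p² dμ : p a real polynomial function of degree ≤ D with ∫ p dμ = 0 }, and define L_∞ := inf { ∫ (Ψ − 1)² dν + ρ⁻¹ ∫ Ψ² dμ : Ψ Borel, ∫ Ψ² d(μ+ν) < ∞, ∫ Ψ dμ = 0 }. Then the sequence (L_D) is non-increasing, L_D ≥ L_∞ for every D, and L_D → L_∞ as D → ∞. -/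
open MeasureTheory Filter

section PolynomialApproximation

variable {κ : Measure ℝ} [IsFiniteMeasure κ] {K : Set ℝ}

lemma Continuous.integrable_of_compl_null {f : ℝ → ℝ} (hf : Continuous f)
    (hK : IsCompact K) (hκ : κ Kᶜ = 0) : Integrable f κ := by
  have h : IntegrableOn f K κ := hf.continuousOn.integrableOn_compact hK
  rwa [IntegrableOn, Measure.restrict_eq_self_of_ae_mem (mem_ae_iff.2 hκ)] at h

lemma Continuous.memLp_two_of_compl_null {f : ℝ → ℝ} (hf : Continuous f)
    (hK : IsCompact K) (hκ : κ Kᶜ = 0) : MemLp f 2 κ :=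
  (memLp_two_iff_integrable_sq hf.aestronglyMeasurable).2
    ((hf.pow 2).integrable_of_compl_null hK hκ)

/-- Polynomials are dense in `L²` of a compactly supported finite measure. -/
lemma exists_polynomial_integral_sq_sub_le (hK : IsCompact K) (hκ : κ Kᶜ = 0)
    {f : ℝ → ℝ} (hf : MemLp f 2 κ) {δ : ℝ} (hδ : 0 < δ) :
    ∃ p : Polynomial ℝ, ∫ x, (p.eval x - f x) ^ 2 ∂κ ≤ δ := by
  obtain ⟨g, hg, hg2⟩ := MemLp.exists_boundedContinuous_integral_rpow_sub_le (μ := κ)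
    (p := 2) two_pos (f := f) (by simpa using hf) (ε := δ / 4) (by positivity)
  replace hg : ∫ x, (f x - g x) ^ 2 ∂κ ≤ δ / 4 := by
    simpa using hg
  replace hg2 : MemLp g 2 κ := by simpa using hg2
  obtain ⟨a, ha⟩ := hK.bddBelow
  obtain ⟨b, hb⟩ := hK.bddAbove
  set m := κ.real Set.univ with hm
  have hm0 : 0 ≤ m := measureReal_nonneg
  obtain ⟨p, hp⟩ := exists_polynomial_near_of_continuousOn a b g g.continuous.continuousOn
    (Real.sqrt (δ / (4 * (m + 1)))) (by positivity)
  refine ⟨p, ?_⟩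
  have hp2 : MemLp (fun x => p.eval x) 2 κ := p.continuous.memLp_two_of_compl_null hK hκ
  have hbound : ∀ᵐ x ∂κ, (p.eval x - f x) ^ 2 ≤ 2 * (δ / (4 * (m + 1))) + 2 * (f x - g x) ^ 2 := by
    filter_upwards [mem_ae_iff.2 hκ] with x hx
    have h1 := hp x ⟨ha hx, hb hx⟩
    have h2 : (p.eval x - g x) ^ 2 ≤ δ / (4 * (m + 1)) := by
      rw [← sq_abs]
      exact (Real.le_sqrt (abs_nonneg _) (by positivity)).1 h1.le
    nlinarith [sq_nonneg (p.eval x - g x + (f x - g x))]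
  have hfg : Integrable (fun x => 2 * (f x - g x) ^ 2) κ := (hf.sub hg2).integrable_sq.const_mul 2
  calc ∫ x, (p.eval x - f x) ^ 2 ∂κ
      ≤ ∫ x, (2 * (δ / (4 * (m + 1))) + 2 * (f x - g x) ^ 2) ∂κ :=
        integral_mono_ae (hp2.sub hf).integrable_sq ((integrable_const _).add hfg) hbound
    _ = m * (2 * (δ / (4 * (m + 1)))) + 2 * ∫ x, (f x - g x) ^ 2 ∂κ := by
        rw [integral_add (integrable_const _) hfg, integral_const, integral_const_mul, smul_eq_mul]
    _ ≤ δ := by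
        have : m * (2 * (δ / (4 * (m + 1)))) ≤ δ / 2 := by
          rw [show m * (2 * (δ / (4 * (m + 1)))) = (δ / 2) * (m / (m + 1)) by field_simp; ring]
          exact mul_le_of_le_one_right (by positivity) (div_le_one_of_le₀ (by linarith) (by linarith))
        linarith

end PolynomialApproximation

lemma sq_integral_le_integral_sq_s13 {μ : Measure ℝ} [IsProbabilityMeasure μ] {f : ℝ → ℝ}
    (hf : MemLp f 2 μ) : (∫ x, f x ∂μ) ^ 2 ≤ ∫ x, f x ^ 2 ∂μ := by
  have h := ProbabilityTheory.variance_nonneg f μ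
  rw [ProbabilityTheory.variance_eq_sub hf] at h
  simpa using h

/-- The polynomials centred under `μ` are dense, in `L²(μ + ν)`, among the functions centred
under `μ`. -/
lemma exists_centered_polynomial_integral_sq_sub_le {μ ν : Measure ℝ} [IsProbabilityMeasure μ]
    [IsFiniteMeasure ν] {K : Set ℝ} (hK : IsCompact K) (hκ : (μ + ν) Kᶜ = 0)
    {f : ℝ → ℝ} (hf : MemLp f 2 (μ + ν)) (hf0 : ∫ x, f x ∂μ = 0) {δ : ℝ} (hδ : 0 < δ) :
    ∃ q : Polynomial ℝ, ∫ x, q.eval x ∂μ = 0 ∧ ∫ x, (q.eval x - f x) ^ 2 ∂(μ + ν) ≤ δ := by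
  set m := (μ + ν).real Set.univ with hm
  have hm0 : 0 ≤ m := measureReal_nonneg
  obtain ⟨p, hp⟩ := exists_polynomial_integral_sq_sub_le hK hκ hf
    (δ := δ / (2 * (m + 1))) (by positivity)
  have hp2 : MemLp (fun x => p.eval x) 2 (μ + ν) := p.continuous.memLp_two_of_compl_null hK hκ
  have hpf : MemLp (fun x => p.eval x - f x) 2 (μ + ν) := hp2.sub hf
  have hpμ : Integrable (fun x => p.eval x) μ := hp2.left_of_add_measure.integrable one_le_two
  have hfμ : Integrable f μ := hf.left_of_add_measure.integrable one_le_two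
  set c := ∫ x, p.eval x ∂μ with hc
  have hc2 : c ^ 2 ≤ δ / (2 * (m + 1)) := by
    have h1 := sq_integral_le_integral_sq_s13 hpf.left_of_add_measure
    rw [integral_sub hpμ hfμ, hf0, sub_zero] at h1
    refine h1.trans (le_trans ?_ hp)
    exact integral_mono_measure (Measure.le_add_right le_rfl)
      (ae_of_all _ fun x => sq_nonneg _) hpf.integrable_sq
  refine ⟨p - Polynomial.C c, ?_, ?_⟩
  · simp only [Polynomial.eval_sub, Polynomial.eval_C]
    rw [integral_sub hpμ (integrable_const _)]
    simp [hc]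
  · have hq2 : MemLp (fun x => (p - Polynomial.C c).eval x) 2 (μ + ν) :=
      (p - Polynomial.C c).continuous.memLp_two_of_compl_null hK hκ
    have hi : Integrable (fun x => 2 * (p.eval x - f x) ^ 2) (μ + ν) :=
      hpf.integrable_sq.const_mul 2
    calc ∫ x, ((p - Polynomial.C c).eval x - f x) ^ 2 ∂(μ + ν)
        ≤ ∫ x, (2 * c ^ 2 + 2 * (p.eval x - f x) ^ 2) ∂(μ + ν) := by
          refine integral_mono (hq2.sub hf).integrable_sq ((integrable_const _).add hi) fun x => ?_
          simp only [Polynomial.eval_sub, Polynomial.eval_C]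
          nlinarith [sq_nonneg (p.eval x - f x + c)]
      _ = m * (2 * c ^ 2) + 2 * ∫ x, (p.eval x - f x) ^ 2 ∂(μ + ν) := by
          rw [integral_add (integrable_const _) hi, integral_const, integral_const_mul,
            smul_eq_mul]
      _ ≤ m * (2 * (δ / (2 * (m + 1)))) + 2 * (δ / (2 * (m + 1))) := by gcongr
      _ = δ := by field_simp

lemma integral_sq_le_of_sq_sub {κ : Measure ℝ} [IsFiniteMeasure κ] {f g : ℝ → ℝ}
    (hf : MemLp f 2 κ) (hg : MemLp g 2 κ) {t : ℝ} (ht : 0 < t) :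
    ∫ x, g x ^ 2 ∂κ ≤ (1 + t) * ∫ x, f x ^ 2 ∂κ + (1 + t⁻¹) * ∫ x, (g x - f x) ^ 2 ∂κ := by
  have h1 := hf.integrable_sq.const_mul (1 + t)
  have h2 : Integrable (fun x => (1 + t⁻¹) * (g x - f x) ^ 2) κ :=
    (hg.sub hf).integrable_sq.const_mul _
  rw [← integral_const_mul, ← integral_const_mul, ← integral_add h1 h2]
  refine integral_mono hg.integrable_sq (h1.add h2) fun x => ?_
  have key : (1 + t) * f x ^ 2 + (1 + t⁻¹) * (g x - f x) ^ 2 - g x ^ 2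
      = t⁻¹ * (t * f x - (g x - f x)) ^ 2 := by
    field_simp
    ring
  have : 0 ≤ t⁻¹ * (t * f x - (g x - f x)) ^ 2 := by positivity
  simp only
  linarith

/-- Among the functions centred under `μ`, the value of the quadratic functional at any
square-integrable one is approached from above by its values at polynomials. -/
lemma exists_centered_polynomial_objective_lt {μ ν : Measure ℝ} [IsProbabilityMeasure μ]
    [IsFiniteMeasure ν] {K : Set ℝ} (hK : IsCompact K) (hκ : (μ + ν) Kᶜ = 0)
    {ρ : ℝ} (hρ : 0 < ρ) {f : ℝ → ℝ} (hf : MemLp f 2 (μ + ν)) (hf0 : ∫ x, f x ∂μ = 0)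
    {ε : ℝ} (hε : 0 < ε) :
    ∃ q : Polynomial ℝ, ∫ x, q.eval x ∂μ = 0 ∧
      (∫ x, (q.eval x - 1) ^ 2 ∂ν) + ρ⁻¹ * ∫ x, (q.eval x) ^ 2 ∂μ <
        (∫ x, (f x - 1) ^ 2 ∂ν) + ρ⁻¹ * (∫ x, f x ^ 2 ∂μ) + ε := by
  set F := (∫ x, (f x - 1) ^ 2 ∂ν) + ρ⁻¹ * (∫ x, f x ^ 2 ∂μ) with hF
  have hF0 : 0 ≤ F := by positivity
  set t := ε / (2 * (F + 1)) with ht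
  have ht0 : 0 < t := by positivity
  set c := (1 + t⁻¹) * (1 + ρ⁻¹) with hc
  have hc0 : 0 < c := by positivity
  obtain ⟨q, hq0, hq⟩ := exists_centered_polynomial_integral_sq_sub_le hK hκ hf hf0
    (δ := ε / (4 * c)) (by positivity)
  refine ⟨q, hq0, ?_⟩
  have hq2 : MemLp (fun x => q.eval x) 2 (μ + ν) := q.continuous.memLp_two_of_compl_null hK hκ
  have hsub : Integrable (fun x => (q.eval x - f x) ^ 2) (μ + ν) := (hq2.sub hf).integrable_sq
  have hν := integral_sq_le_of_sq_sub
    (hf.right_of_add_measure.sub (memLp_const 1)) (hq2.right_of_add_measure.sub (memLp_const 1)) ht0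
  have hμ := integral_sq_le_of_sq_sub hf.left_of_add_measure hq2.left_of_add_measure ht0
  simp only [Pi.sub_apply, sub_sub_sub_cancel_right] at hν
  rw [integral_add_measure hsub.left_of_add_measure hsub.right_of_add_measure] at hq
  set A := ∫ x, (q.eval x - f x) ^ 2 ∂μ
  set B := ∫ x, (q.eval x - f x) ^ 2 ∂ν
  have hA : 0 ≤ A := by positivity
  have hB : 0 ≤ B := by positivity
  have hρ' : 0 < ρ⁻¹ := inv_pos.2 hρ
  have hAB : B + ρ⁻¹ * A ≤ (1 + ρ⁻¹) * (A + B) := by nlinarith [mul_nonneg hρ'.le hB]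
  have htF : t * F < ε / 2 + ε / 4 := by
    have : t * (F + 1) = ε / 2 := by rw [ht]; field_simp
    nlinarith
  have hsmall : (1 + t⁻¹) * (B + ρ⁻¹ * A) ≤ ε / 4 := by
    calc (1 + t⁻¹) * (B + ρ⁻¹ * A) ≤ (1 + t⁻¹) * ((1 + ρ⁻¹) * (A + B)) := by gcongr
      _ = c * (A + B) := by rw [hc]; ring
      _ ≤ c * (ε / (4 * c)) := by gcongr
      _ = ε / 4 := by field_simp
  have := mul_le_mul_of_nonneg_left hμ hρ'.le
  calc _ ≤ (1 + t) * F + (1 + t⁻¹) * (B + ρ⁻¹ * A) := by rw [hF]; linarith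
    _ < F + ε := by linarith

/-- Large-degree limit of the polynomial variational problems: the degree-`D` optimal values
`L D` are non-increasing in `D`, dominate the unrestricted optimal value `Linf`, and converge
to `Linf` as `D → ∞`. -/
theorem stmt_13 (μ ν : Measure ℝ) [IsProbabilityMeasure μ] [IsFiniteMeasure ν]
    (hμc : ∃ K : Set ℝ, IsCompact K ∧ μ Kᶜ = 0)
    (hνc : ∃ K : Set ℝ, IsCompact K ∧ ν Kᶜ = 0)
    (ρ : ℝ) (hρ : 0 < ρ) :
    let L : ℕ → ℝ := fun D => sInf {r : ℝ | ∃ p : Polynomial ℝ, p.natDegree ≤ D ∧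
        (∫ x, p.eval x ∂μ) = 0 ∧
        r = (∫ x, (p.eval x - 1) ^ 2 ∂ν) + ρ⁻¹ * ∫ x, (p.eval x) ^ 2 ∂μ}
    let Linf : ℝ := sInf {r : ℝ | ∃ Ψ : ℝ → ℝ, Measurable Ψ ∧
        Integrable (fun x => Ψ x ^ 2) (μ + ν) ∧ (∫ x, Ψ x ∂μ) = 0 ∧
        r = (∫ x, (Ψ x - 1) ^ 2 ∂ν) + ρ⁻¹ * ∫ x, Ψ x ^ 2 ∂μ}
    (∀ D D' : ℕ, D ≤ D' → L D' ≤ L D) ∧ (∀ D : ℕ, Linf ≤ L D) ∧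
      Tendsto L atTop (nhds Linf) := by
  intro L Linf
  obtain ⟨K₁, hK₁, hμK⟩ := hμc
  obtain ⟨K₂, hK₂, hνK⟩ := hνc
  have hK := hK₁.union hK₂
  have hκ : (μ + ν) (K₁ ∪ K₂)ᶜ = 0 := by
    rw [Measure.add_apply, measure_mono_null (Set.compl_subset_compl.2 Set.subset_union_left) hμK,
      measure_mono_null (Set.compl_subset_compl.2 Set.subset_union_right) hνK, add_zero]
  have hbdd : ∀ D : ℕ, BddBelow {r : ℝ | ∃ p : Polynomial ℝ, p.natDegree ≤ D ∧
        (∫ x, p.eval x ∂μ) = 0 ∧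
        r = (∫ x, (p.eval x - 1) ^ 2 ∂ν) + ρ⁻¹ * ∫ x, (p.eval x) ^ 2 ∂μ} := by
    rintro D
    refine ⟨0, ?_⟩
    rintro r ⟨p, -, -, rfl⟩
    positivity
  have hne : ∀ D : ℕ, {r : ℝ | ∃ p : Polynomial ℝ, p.natDegree ≤ D ∧
        (∫ x, p.eval x ∂μ) = 0 ∧
        r = (∫ x, (p.eval x - 1) ^ 2 ∂ν) + ρ⁻¹ * ∫ x, (p.eval x) ^ 2 ∂μ}.Nonempty :=
    fun D => ⟨_, 0, by simp, by simp, rfl⟩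
  have hanti : Antitone L := by
    intro D D' h
    refine csInf_le_csInf (hbdd D') (hne D) ?_
    rintro r ⟨p, hp, h⟩
    exact ⟨p, hp.trans ‹_›, h⟩
  have hle : ∀ D, Linf ≤ L D := by
    intro D
    refine csInf_le_csInf ⟨0, ?_⟩ (hne D) ?_
    · rintro r ⟨Ψ, -, -, -, rfl⟩
      positivity
    · rintro r ⟨p, -, h⟩
      exact ⟨fun x => p.eval x, p.continuous.measurable,
        (p.continuous.pow 2).integrable_of_compl_null hK hκ, h⟩
  refine ⟨fun D D' h => hanti h, hle, tendsto_atTop_isGLB hanti ⟨?_, ?_⟩⟩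
  · rintro _ ⟨D, rfl⟩
    exact hle D
  · intro b hb
    refine le_csInf ⟨_, fun _ => 0, measurable_const, by simp, by simp, rfl⟩ ?_
    rintro r ⟨Ψ, hΨ, hΨ2, hΨ0, rfl⟩
    refine le_of_forall_pos_lt_add fun ε hε => ?_
    obtain ⟨q, hq0, hq⟩ := exists_centered_polynomial_objective_lt hK hκ hρ
      ((memLp_two_iff_integrable_sq hΨ.aestronglyMeasurable).2 hΨ2) hΨ0 hε
    exact ((hb ⟨q.natDegree, rfl⟩).trans
      (csInf_le (hbdd _) ⟨q, le_rfl, hq0, rfl⟩)).trans_lt hq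
end

section
/- Let F be a nonempty set, for each integer t ≥ 1 let M_t : F^t → [0,1], and let A : [0,1] → [0,1] be non-decreasing. Assume that for every t ≥ 2 and every (f₁, …, f_{t−1}) ∈ F^{t−1}, inf_{f ∈ F} M_t(f₁, …, f_{t−1}, f) = A(M_{t−1}(f₁, …, f_{t−1})). Let (f*_t)_{t ≥ 1} be a greedy sequence, i.e. M₁(f*₁) = inf_{f ∈ F} M₁(f) and, for every t ≥ 2, M_t(f*₁, …, f*_{t−1}, f*_t) = inf_{f ∈ F} M_t(f*₁, …, f*_{t−1}, f). Then the greedy sequence is globally optimal: for every t ≥ 1 and every (f₁, …, f_t) ∈ F^t, M_t(f*₁, …, f*_t) ≤ M_t(f₁, …, f_t). -/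
/-- Greedy optimality induction principle: if the optimal one-step improvement of the error
functionals `M` depends on the past only through the current error via a non-decreasing map
`A`, then a greedy sequence of choices is globally optimal. Here `M t` plays the role of
`M_{t+1} : F^{t+1} → [0,1]`. -/
theorem stmt_19 {F : Type*} [Nonempty F]
    (M : (t : ℕ) → (Fin (t + 1) → F) → ℝ)
    (hM : ∀ (t : ℕ) (f : Fin (t + 1) → F), M t f ∈ Set.Icc (0:ℝ) 1)
    (A : ℝ → ℝ) (hA : MonotoneOn A (Set.Icc (0:ℝ) 1))
    (hAmap : ∀ r ∈ Set.Icc (0:ℝ) 1, A r ∈ Set.Icc (0:ℝ) 1)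
    (hstruct : ∀ (t : ℕ) (f : Fin (t + 1) → F),
      (⨅ g : F, M (t + 1) (Fin.snoc f g)) = A (M t f))
    (fstar : ℕ → F)
    (hgreedy0 : M 0 (fun _ => fstar 0) = ⨅ g : F, M 0 (fun _ => g))
    (hgreedy : ∀ t : ℕ,
      M (t + 1) (Fin.snoc (fun i : Fin (t + 1) => fstar i.val) (fstar (t + 1))) =
        ⨅ g : F, M (t + 1) (Fin.snoc (fun i : Fin (t + 1) => fstar i.val) g)) :
    ∀ (t : ℕ) (f : Fin (t + 1) → F),
      M t (fun i => fstar i.val) ≤ M t f := by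
  have bdd : ∀ (t : ℕ) (φ : F → Fin (t + 1) → F), BddBelow (Set.range fun g => M t (φ g)) :=
    fun t φ => ⟨0, Set.forall_mem_range.2 fun g => (hM t (φ g)).1⟩
  intro t
  induction t with
  | zero =>
    intro f
    have hstar : (fun i : Fin 1 => fstar i.val) = fun _ => fstar 0 := by
      funext i
      rw [Fin.val_eq_zero i]
    have hf : f = fun _ => f 0 := by
      funext i
      rw [Subsingleton.elim (α := Fin 1) i 0]
    rw [hstar, hgreedy0, hf]
    exact ciInf_le (bdd 0 fun g _ => g) (f 0)
  | succ t ih =>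
    intro f
    have hstar : (fun i : Fin (t + 1 + 1) => fstar i.val) =
        Fin.snoc (fun i : Fin (t + 1) => fstar i.val) (fstar (t + 1)) := by
      funext i
      refine Fin.lastCases ?_ (fun j => ?_) i <;> simp
    have hf : Fin.snoc (Fin.init f) (f (Fin.last (t + 1))) = f := Fin.snoc_init_self f
    calc M (t + 1) (fun i => fstar i.val)
        = A (M t fun i => fstar i.val) := by rw [hstar, hgreedy, hstruct]
      _ ≤ A (M t (Fin.init f)) := hA (hM _ _) (hM _ _) (ih _)
      _ = ⨅ g : F, M (t + 1) (Fin.snoc (Fin.init f) g) := (hstruct _ _).symm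
      _ ≤ M (t + 1) (Fin.snoc (Fin.init f) (f (Fin.last (t + 1)))) :=
        ciInf_le (bdd (t + 1) fun g => Fin.snoc (Fin.init f) g) (f (Fin.last (t + 1)))
      _ = M (t + 1) f := by rw [hf]
end
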